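/- arXiv:2106.09956 — 4 statements merged into one kernel-verified Lean document; each statement's English description precedes it below -/
import Mathlib

section
/- Let m ≥ 1, k ∈ ℕ, and let P be a polynomial in m variables with complex coefficients that is homogeneous of degree k and harmonic, i.e. Σ_{j=1}^m ∂²P/∂x_j² = 0 (as polynomials). Then for every z ∈ ℂ^m, (2π)^{-m/2} ∫_{ℝ^m} exp(-(z·z)/2 + x·z − |x|²/2) · P(x) dx = P(z), where P(z) denotes the evaluation of P at the complex point z. Equivalently, the Segal–Bargmann transform maps P(x)·exp(-|x|²/4) to the polynomial P(z). -/
open MeasureTheory Complex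

open scoped Real

section GaussianWeight

variable {ι : Type*}

theorem pderiv_pderiv_comm (i j : ι) (Q : MvPolynomial ι ℂ) :
    MvPolynomial.pderiv i (MvPolynomial.pderiv j Q) =
      MvPolynomial.pderiv j (MvPolynomial.pderiv i Q) := by
  classical
  have h : ⁅MvPolynomial.pderiv (R := ℂ) i, MvPolynomial.pderiv (R := ℂ) j⁆ = 0 := by
    refine MvPolynomial.derivation_ext fun k => ?_
    simp [Derivation.commutator_apply, MvPolynomial.pderiv_X, Pi.single_apply, apply_ite]
  have := congrArg (fun D => D Q) h
  simpa [Derivation.commutator_apply, sub_eq_zero] using this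

/-- Evaluation of a complex polynomial at a real point. -/
noncomputable def evalReal (x : ι → ℝ) : MvPolynomial ι ℂ →+* ℂ :=
  MvPolynomial.eval fun j => (x j : ℂ)

theorem continuous_evalReal (Q : MvPolynomial ι ℂ) : Continuous fun x : ι → ℝ => evalReal x Q :=
  (MvPolynomial.continuous_eval Q).comp (f := fun (x : ι → ℝ) (j : ι) => (x j : ℂ)) (by fun_prop)

theorem hasLineDerivAt_evalReal [DecidableEq ι] (Q : MvPolynomial ι ℂ) (x : ι → ℝ) (i : ι) :
    HasLineDerivAt ℝ (fun y => evalReal y Q) (evalReal x (MvPolynomial.pderiv i Q)) x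
      (Pi.single i 1) := by
  unfold HasLineDerivAt
  induction Q using MvPolynomial.induction_on with
  | C a => simpa [evalReal] using hasDerivAt_const (0 : ℝ) a
  | add p q hp hq => simpa only [map_add] using hp.fun_add hq
  | mul_X p j hp =>
    have hj : HasDerivAt (fun t : ℝ => evalReal (x + t • Pi.single i 1) (MvPolynomial.X j))
        (evalReal x (MvPolynomial.pderiv i (MvPolynomial.X j))) 0 := by
      have h := (((hasDerivAt_id (0 : ℝ)).mul_const
        ((Pi.single i 1 : ι → ℝ) j)).const_add (x j)).ofReal_comp
      have h' : evalReal x (MvPolynomial.pderiv i (MvPolynomial.X j : MvPolynomial ι ℂ)) =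
          ((1 * (Pi.single i 1 : ι → ℝ) j : ℝ) : ℂ) := by
        rcases eq_or_ne i j with rfl | hij
        · simp
        · simp [MvPolynomial.pderiv_X_of_ne hij.symm, Pi.single_eq_of_ne hij.symm]
      rw [h']
      simpa [evalReal] using h
    simp only [map_mul, Derivation.leibniz, smul_eq_mul, map_add]
    refine (hp.fun_mul hj).congr_deriv ?_
    simp only [zero_smul, add_zero]
    ring

variable [Fintype ι]

/-- The Gaussian weight `exp (x·z - |x|²/2)` on `ℝ^ι` with complex parameter `z`. -/
noncomputable def gaussianWeight (z : ι → ℂ) (x : ι → ℝ) : ℂ :=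
  Complex.exp ((∑ j, (x j : ℂ) * z j) - (∑ j, (x j : ℂ) ^ 2) / 2)

theorem continuous_gaussianWeight (z : ι → ℂ) : Continuous (gaussianWeight z) := by
  unfold gaussianWeight
  fun_prop

theorem gaussianWeight_eq (z : ι → ℂ) (x : ι → ℝ) :
    gaussianWeight z x =
      Complex.exp (-(1 / 2 : ℂ) * ∑ i, (x i : ℂ) ^ 2 + ∑ i, z i * (x i : ℂ)) := by
  rw [gaussianWeight]
  congr 1
  simp only [mul_comm (z _)]
  ring

theorem integrable_gaussianWeight (z : ι → ℂ) : Integrable (gaussianWeight z) := by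
  simp_rw [funext (gaussianWeight_eq z)]
  exact GaussianFourier.integrable_cexp_neg_mul_sum_add (by norm_num) z

theorem integral_gaussianWeight (z : ι → ℂ) :
    ∫ x, gaussianWeight z x =
      (2 * π : ℂ) ^ (Fintype.card ι / 2 : ℂ) * Complex.exp ((∑ i, z i ^ 2) / 2) := by
  simp_rw [gaussianWeight_eq]
  rw [GaussianFourier.integral_cexp_neg_mul_sum_add (by norm_num) z]
  congr 2 <;> ring

theorem gaussianWeight_add_single [DecidableEq ι] (z : ι → ℂ) (i : ι) (c : ℝ) (x : ι → ℝ) :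
    gaussianWeight (z + Pi.single i (c : ℂ)) x =
      (Real.exp (c * x i) : ℂ) * gaussianWeight z x := by
  rw [gaussianWeight, gaussianWeight, Complex.ofReal_exp, ← Complex.exp_add]
  congr 1
  simp only [Pi.add_apply, mul_add, Finset.sum_add_distrib, Pi.single_apply, mul_ite, mul_zero,
    Finset.sum_ite_eq', Finset.mem_univ, if_true]
  push_cast
  ring

theorem integrable_gaussianWeight_mul_eval (Q : MvPolynomial ι ℂ) (z : ι → ℂ) :
    Integrable fun x : ι → ℝ => gaussianWeight z x * evalReal x Q := by
  classical
  induction Q using MvPolynomial.induction_on generalizing z with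
  | C a => simpa [evalReal] using (integrable_gaussianWeight z).mul_const a
  | add p q hp hq => simpa only [map_add, mul_add] using (hp z).fun_add (hq z)
  | mul_X p i hp =>
    refine ((hp (z + Pi.single i ((1 : ℝ) : ℂ))).norm.add
      (hp (z + Pi.single i ((-1 : ℝ) : ℂ))).norm).mono'
      ((continuous_gaussianWeight z).mul (continuous_evalReal _)).aestronglyMeasurable
      (Filter.Eventually.of_forall fun x => ?_)
    have hx : |x i| ≤ Real.exp (1 * x i) + Real.exp (-1 * x i) := by
      have h₁ := Real.add_one_le_exp (1 * x i)
      have h₂ := Real.add_one_le_exp (-1 * x i)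
      have h₃ := Real.exp_pos (1 * x i)
      have h₄ := Real.exp_pos (-1 * x i)
      rcases abs_cases (x i) with h | h <;> linarith
    have hX : evalReal x (MvPolynomial.X i) = (x i : ℂ) := by simp [evalReal]
    simp only [Pi.add_apply, gaussianWeight_add_single, map_mul, hX, norm_mul, Complex.norm_real,
      Real.norm_eq_abs, Real.abs_exp]
    calc _ = |x i| * (‖gaussianWeight z x‖ * ‖evalReal x p‖) := by ring
      _ ≤ (Real.exp (1 * x i) + Real.exp (-1 * x i)) *
          (‖gaussianWeight z x‖ * ‖evalReal x p‖) := by gcongr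
      _ = _ := by ring

theorem hasLineDerivAt_gaussianWeight [DecidableEq ι] (z : ι → ℂ) (x : ι → ℝ) (i : ι) :
    HasLineDerivAt ℝ (gaussianWeight z) (gaussianWeight z x * (z i - x i)) x (Pi.single i 1) := by
  let q : MvPolynomial ι ℂ :=
    (∑ j, MvPolynomial.X j * MvPolynomial.C (z j)) -
      (∑ j, MvPolynomial.X j ^ 2) * MvPolynomial.C (1 / 2)
  have hq (y : ι → ℝ) : gaussianWeight z y = Complex.exp (evalReal y q) := by
    simp [gaussianWeight, evalReal, q, div_eq_mul_inv]
  have hq' : evalReal x (MvPolynomial.pderiv i q) = z i - x i := by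
    simp [evalReal, q, MvPolynomial.pderiv_X, Pi.single_apply, Derivation.leibniz_pow, apply_ite]
  have h := (hasLineDerivAt_evalReal q x i).cexp
  rw [hq'] at h
  unfold HasLineDerivAt
  simpa [hq] using h

/-- Integration by parts against the Gaussian weight. -/
theorem integral_gaussianWeight_mul_X_mul (Q : MvPolynomial ι ℂ) (z : ι → ℂ) (i : ι) :
    ∫ x : ι → ℝ, gaussianWeight z x * evalReal x (MvPolynomial.X i * Q) =
      z i * (∫ x : ι → ℝ, gaussianWeight z x * evalReal x Q) +
        ∫ x : ι → ℝ, gaussianWeight z x * evalReal x (MvPolynomial.pderiv i Q) := by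
  classical
  have hQ := integrable_gaussianWeight_mul_eval Q z
  have hXQ := integrable_gaussianWeight_mul_eval (MvPolynomial.X i * Q) z
  have hdQ := integrable_gaussianWeight_mul_eval (MvPolynomial.pderiv i Q) z
  let g' : (ι → ℝ) → ℂ := fun x => z i * (gaussianWeight z x * evalReal x Q) +
    gaussianWeight z x * evalReal x (MvPolynomial.pderiv i Q) -
    gaussianWeight z x * evalReal x (MvPolynomial.X i * Q)
  have hg' : Integrable g' := ((hQ.const_mul _).add hdQ).sub hXQ
  have hderiv (x : ι → ℝ) : HasLineDerivAt ℝ (fun y => gaussianWeight z y * evalReal y Q) (g' x) x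
      (Pi.single i 1) := by
    refine ((hasLineDerivAt_gaussianWeight z x i).fun_mul
      (hasLineDerivAt_evalReal Q x i)).congr_deriv ?_
    simp only [g', map_mul, zero_smul, add_zero]
    rw [show evalReal x (MvPolynomial.X i) = (x i : ℂ) by simp [evalReal]]
    ring
  have h : ∫ x, g' x = 0 := by
    simpa using integral_bilinear_hasLineDerivAt_right_eq_neg_left_of_integrable
      (μ := (volume : Measure (ι → ℝ))) (B := ContinuousLinearMap.mul ℝ ℂ) (f := fun _ => 1)
      (f' := fun _ => 0) (v := Pi.single i 1) (by simp) (by simpa using hg') (by simpa using hQ)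
      (fun x _ => hasDerivAt_const (0 : ℝ) (1 : ℂ)) (fun x _ => hderiv x)
  simp only [g'] at h
  rw [integral_sub ((hQ.const_mul _).fun_add hdQ) hXQ, integral_add (hQ.const_mul _) hdQ,
    integral_const_mul, sub_eq_zero] at h
  exact h.symm

theorem integral_gaussianWeight_mul_sum {κ : Type*} (s : Finset κ) (Q : κ → MvPolynomial ι ℂ)
    (z : ι → ℂ) :
    ∫ x : ι → ℝ, gaussianWeight z x * evalReal x (∑ i ∈ s, Q i) =
      ∑ i ∈ s, ∫ x : ι → ℝ, gaussianWeight z x * evalReal x (Q i) := by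
  simp only [map_sum, Finset.mul_sum]
  exact integral_finsetSum _ fun i _ => integrable_gaussianWeight_mul_eval (Q i) z

theorem integral_gaussianWeight_mul_harmonic {k : ℕ} {P : MvPolynomial ι ℂ}
    (hhom : P.IsHomogeneous k)
    (hharm : ∑ j, MvPolynomial.pderiv j (MvPolynomial.pderiv j P) = 0) (z : ι → ℂ) :
    ∫ x : ι → ℝ, gaussianWeight z x * evalReal x P =
      MvPolynomial.eval z P * ∫ x : ι → ℝ, gaussianWeight z x := by
  induction k generalizing P with
  | zero =>
    rw [MvPolynomial.totalDegree_eq_zero_iff_eq_C.mp (Nat.le_zero.mp hhom.totalDegree_le)]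
    simp [evalReal, integral_mul_const, mul_comm]
  | succ k ih =>
    have hd (j : ι) := ih (P := MvPolynomial.pderiv j P) hhom.pderiv (by
      simp_rw [pderiv_pderiv_comm _ j, ← map_sum, hharm, map_zero])
    have euler := hhom.sum_X_mul_pderiv
    have hl := congrArg (fun Q => ∫ x : ι → ℝ, gaussianWeight z x * evalReal x Q) euler
    have hr := congrArg (MvPolynomial.eval z) euler
    simp only [integral_gaussianWeight_mul_sum, integral_gaussianWeight_mul_X_mul,
      Finset.sum_add_distrib] at hl
    rw [← integral_gaussianWeight_mul_sum, hharm] at hl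
    simp only [hd, map_zero, mul_zero, integral_zero, add_zero, nsmul_eq_mul, map_mul,
      map_natCast, map_sum, MvPolynomial.eval_X, mul_left_comm _ ((k + 1 : ℕ) : ℂ),
      integral_const_mul] at hl hr
    have hk : ((k + 1 : ℕ) : ℂ) ≠ 0 := Nat.cast_ne_zero.mpr k.succ_ne_zero
    apply mul_left_cancel₀ hk
    rw [← hl, ← mul_assoc, ← hr, Finset.sum_mul]
    simp only [mul_assoc]

end GaussianWeight

/-- The Segal–Bargmann transform maps `P(x)·exp(-|x|²/4)` to the polynomial `P(z)`,
for every harmonic homogeneous polynomial `P` of degree `k` (e.g. a component of an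
inner spherical monogenic):
`(2π)^{-m/2} ∫_{ℝ^m} exp(-(z·z)/2 + x·z - |x|²/2) P(x) dx = P(z)` for all `z ∈ ℂ^m`. -/
theorem segalBargmann_harmonic_homogeneous_polynomial
    (m : ℕ) (hm : 1 ≤ m) (k : ℕ) (P : MvPolynomial (Fin m) ℂ)
    (hhom : P.IsHomogeneous k)
    (hharm : ∑ j : Fin m, MvPolynomial.pderiv j (MvPolynomial.pderiv j P) = 0) :
    ∀ z : Fin m → ℂ,
      ((2 * Real.pi) ^ (-(m : ℝ) / 2) : ℝ) •
          ∫ x : Fin m → ℝ,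
            Complex.exp
                (-(∑ j, z j ^ 2) / 2 + (∑ j, (x j : ℂ) * z j) - (∑ j, (x j : ℂ) ^ 2) / 2) *
              MvPolynomial.eval (fun j => (x j : ℂ)) P =
        MvPolynomial.eval z P := by
  intro z
  have hint (x : Fin m → ℝ) :
      Complex.exp (-(∑ j, z j ^ 2) / 2 + (∑ j, (x j : ℂ) * z j) - (∑ j, (x j : ℂ) ^ 2) / 2) *
          MvPolynomial.eval (fun j => (x j : ℂ)) P =
        Complex.exp (-(∑ j, z j ^ 2) / 2) * (gaussianWeight z x * evalReal x P) := by
    rw [add_sub_assoc, Complex.exp_add, mul_assoc]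
    rfl
  have hpi : (((2 * Real.pi) ^ (-(m : ℝ) / 2) : ℝ) : ℂ) * (2 * π : ℂ) ^ (m / 2 : ℂ) = 1 := by
    rw [Complex.ofReal_cpow (by positivity)]
    push_cast
    rw [← Complex.cpow_add _ _ (by simp [Real.pi_ne_zero]), neg_div, neg_add_cancel,
      Complex.cpow_zero]
  have hexp : Complex.exp (-(∑ j, z j ^ 2) / 2) * Complex.exp ((∑ j, z j ^ 2) / 2) = 1 := by
    rw [← Complex.exp_add, neg_div, neg_add_cancel, Complex.exp_zero]
  simp_rw [hint]
  rw [integral_const_mul, integral_gaussianWeight_mul_harmonic hhom hharm,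
    integral_gaussianWeight, Fintype.card_fin, Complex.real_smul]
  linear_combination (MvPolynomial.eval z P) * hexp +
    (MvPolynomial.eval z P) *
      (Complex.exp (-(∑ j, z j ^ 2) / 2) * Complex.exp ((∑ j, z j ^ 2) / 2)) * hpi
end

section
/- Let m ≥ 1, k ∈ ℕ, and let P be a polynomial in m variables with complex coefficients that is homogeneous of degree k and harmonic, i.e. Σ_{j=1}^m ∂²P/∂x_j² = 0 (as polynomials). Then for all t, ω ∈ ℝ^m, setting z ∈ ℂ^m with z_j = t_j + i·ω_j, one has (2π)^{-m/2} ∫_{ℝ^m} P(x) · exp(-|x|²/4) · exp(-|x − 2t|²/4) · exp(i ω·x) dx = exp(-|z|²/2) · exp(i ω·t) · P(z), where P(z) denotes the evaluation of P at the complex point z. -/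
open MeasureTheory Complex

/-- The `n`-th moment of the complex Gaussian weight `exp (-x ^ 2 / 2 + z * x)` on the real line. -/
noncomputable def gaussianMoment (z : ℂ) (n : ℕ) : ℂ :=
  ∫ x : ℝ, (x : ℂ) ^ n * cexp (-(1 / 2) * (x : ℂ) ^ 2 + z * x + 0)

theorem integrable_pow_mul_cexp_quadratic (z : ℂ) (n : ℕ) :
    Integrable fun x : ℝ => (x : ℂ) ^ n * cexp (-(1 / 2) * (x : ℂ) ^ 2 + z * x + 0) := by
  have hb : 0 < (1 / 2 : ℂ).re := by norm_num
  have h₁ := (integrable_cexp_quadratic hb (z + 1) 0).norm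
  have h₂ := (integrable_cexp_quadratic hb (z - 1) 0).norm
  refine ((h₁.add h₂).const_mul (n.factorial : ℝ)).mono' (by fun_prop) (.of_forall fun x => ?_)
  have hpow : |x| ^ n ≤ n.factorial * Real.exp |x| := by
    have := Real.pow_div_factorial_le_exp |x| (abs_nonneg x) n
    rwa [div_le_iff₀' (by positivity)] at this
  have habs : Real.exp |x| ≤ Real.exp x + Real.exp (-x) := by
    rcases abs_cases x with h | h <;> rw [h.1] <;> linarith [Real.exp_pos x, Real.exp_pos (-x)]
  have hadd (c : ℝ) : ‖cexp (-(1 / 2) * (x : ℂ) ^ 2 + (z + c) * x + 0)‖ =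
      Real.exp (c * x) * ‖cexp (-(1 / 2) * (x : ℂ) ^ 2 + z * x + 0)‖ := by
    rw [← Complex.norm_of_nonneg (Real.exp_pos (c * x)).le, ← norm_mul, ofReal_exp,
      ← Complex.exp_add]
    congr 2
    push_cast
    ring
  have hplus := hadd 1
  have hminus := hadd (-1)
  push_cast at hplus hminus
  rw [one_mul] at hplus
  rw [neg_one_mul, ← sub_eq_add_neg] at hminus
  simp only [Pi.add_apply, hplus, hminus, norm_mul, norm_pow, Complex.norm_real, Real.norm_eq_abs]
  rw [← add_mul, ← mul_assoc]
  gcongr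
  exact hpow.trans (by gcongr)

theorem gaussianMoment_zero (z : ℂ) :
    gaussianMoment z 0 = (2 * Real.pi : ℂ) ^ (1 / 2 : ℂ) * cexp (z ^ 2 / 2) := by
  have h := integral_cexp_quadratic (b := -(1 / 2)) (by norm_num) z 0
  simp only [gaussianMoment, pow_zero, one_mul, h]
  congr 2 <;> ring_nf

theorem gaussianMoment_succ (z : ℂ) (n : ℕ) :
    gaussianMoment z (n + 1) = z * gaussianMoment z n + n * gaussianMoment z (n - 1) := by
  have hderiv (x : ℝ) :
      HasDerivAt (fun x : ℝ => (x : ℂ) ^ n * cexp (-(1 / 2) * (x : ℂ) ^ 2 + z * x + 0))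
        (n * ((x : ℂ) ^ (n - 1) * cexp (-(1 / 2) * (x : ℂ) ^ 2 + z * x + 0)) +
          z * ((x : ℂ) ^ n * cexp (-(1 / 2) * (x : ℂ) ^ 2 + z * x + 0)) -
          (x : ℂ) ^ (n + 1) * cexp (-(1 / 2) * (x : ℂ) ^ 2 + z * x + 0)) x := by
    have hid := (hasDerivAt_id (x : ℂ))
    have h := ((hid.pow n).mul
      ((((hid.pow 2).const_mul (-(1 / 2) : ℂ)).add (hid.const_mul z)).add_const 0).cexp).comp_ofReal
    refine h.congr_deriv ?_
    simp
    ring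
  have hi := integrable_pow_mul_cexp_quadratic z
  have hadd := ((hi (n - 1)).const_mul (n : ℂ)).add ((hi n).const_mul z)
  have h := integral_eq_zero_of_hasDerivAt_of_integrable hderiv (hadd.sub (hi (n + 1))) (hi n)
  rw [integral_sub (by exact hadd) (hi _), integral_add ((hi _).const_mul _) ((hi _).const_mul _),
    integral_const_mul, integral_const_mul] at h
  simp only [gaussianMoment]
  linear_combination -h

section Multivariate

variable {ι : Type*} [Fintype ι]

open MvPolynomial

theorem eval_monomial_mul_prod_cexp (z : ι → ℂ) (s : ι →₀ ℕ) (c : ℂ) (x : ι → ℝ) :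
    eval (fun j => (x j : ℂ)) (monomial s c) *
        ∏ j, cexp (-(1 / 2) * (x j : ℂ) ^ 2 + z j * x j + 0) =
      c * ∏ j, (x j : ℂ) ^ s j * cexp (-(1 / 2) * (x j : ℂ) ^ 2 + z j * x j + 0) := by
  rw [eval_monomial, Finsupp.prod_fintype _ _ (fun _ => pow_zero _), mul_assoc,
    Finset.prod_mul_distrib]

theorem integrable_eval_mul_prod_cexp (z : ι → ℂ) (Q : MvPolynomial ι ℂ) :
    Integrable fun x : ι → ℝ => eval (fun j => (x j : ℂ)) Q *
      ∏ j, cexp (-(1 / 2) * (x j : ℂ) ^ 2 + z j * x j + 0) := by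
  induction Q using MvPolynomial.induction_on' with
  | monomial s c =>
    simp only [eval_monomial_mul_prod_cexp]
    exact (Integrable.fintype_prod (f := fun j (x : ℝ) =>
      (x : ℂ) ^ s j * cexp (-(1 / 2) * (x : ℂ) ^ 2 + z j * x + 0))
      fun j => integrable_pow_mul_cexp_quadratic (z j) (s j)).const_mul c
  | add p q hp hq =>
    simp only [map_add, add_mul]
    exact hp.add hq

/-- Integration of a polynomial against the complex Gaussian weight
`∏ j, exp (-x j ^ 2 / 2 + z j * x j)`, as a linear functional. -/
noncomputable def gaussianIntegral (z : ι → ℂ) : MvPolynomial ι ℂ →ₗ[ℂ] ℂ where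
  toFun Q := ∫ x : ι → ℝ, eval (fun j => (x j : ℂ)) Q *
    ∏ j, cexp (-(1 / 2) * (x j : ℂ) ^ 2 + z j * x j + 0)
  map_add' p q := by
    simp only [map_add, add_mul]
    exact integral_add (integrable_eval_mul_prod_cexp z p) (integrable_eval_mul_prod_cexp z q)
  map_smul' c p := by
    simp only [smul_eval, mul_assoc, RingHom.id_apply, smul_eq_mul, integral_const_mul]

theorem gaussianIntegral_apply (z : ι → ℂ) (Q : MvPolynomial ι ℂ) :
    gaussianIntegral z Q = ∫ x : ι → ℝ, eval (fun j => (x j : ℂ)) Q *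
      ∏ j, cexp (-(1 / 2) * (x j : ℂ) ^ 2 + z j * x j + 0) :=
  rfl

theorem gaussianIntegral_monomial (z : ι → ℂ) (s : ι →₀ ℕ) (c : ℂ) :
    gaussianIntegral z (monomial s c) = c * ∏ j, gaussianMoment (z j) (s j) := by
  simp only [gaussianIntegral_apply, eval_monomial_mul_prod_cexp, integral_const_mul]
  rw [integral_fintype_prod_volume_eq_prod (f := fun j (x : ℝ) =>
      (x : ℂ) ^ s j * cexp (-(1 / 2) * (x : ℂ) ^ 2 + z j * x + 0))]
  rfl

/-- Gaussian integration by parts. -/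
theorem gaussianIntegral_X_mul (z : ι → ℂ) (j : ι) (Q : MvPolynomial ι ℂ) :
    gaussianIntegral z (X j * Q) =
      z j * gaussianIntegral z Q + gaussianIntegral z (pderiv j Q) := by
  classical
  induction Q using MvPolynomial.induction_on' with
  | monomial s c =>
    have hrest (s' : ι →₀ ℕ) (h : ∀ i ≠ j, s' i = s i) :
        ∏ i, gaussianMoment (z i) (s' i) = gaussianMoment (z j) (s' j) *
          ∏ i ∈ {j}ᶜ, gaussianMoment (z i) (s i) := by
      rw [Fintype.prod_eq_mul_prod_compl j]
      congr 1
      refine Finset.prod_congr rfl fun i hi => ?_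
      rw [h i (by simpa using hi)]
    rw [X, monomial_mul, pderiv_monomial]
    simp only [gaussianIntegral_monomial]
    rw [hrest (Finsupp.single j 1 + s) (fun i hi => by simp [hi.symm]), hrest s (fun _ _ => rfl),
      hrest (s - Finsupp.single j 1) (fun i hi => by simp [hi.symm])]
    simp only [Finsupp.add_apply, Finsupp.tsub_apply, Finsupp.single_eq_same, add_comm 1,
      gaussianMoment_succ]
    ring
  | add p q hp hq =>
    simp only [mul_add, map_add, hp, hq]
    ring

theorem gaussianIntegral_C (z : ι → ℂ) (c : ℂ) :
    gaussianIntegral z (C c) = ((2 * Real.pi : ℂ) ^ (1 / 2 : ℂ)) ^ Fintype.card ι *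
      cexp ((∑ j, z j ^ 2) / 2) * c := by
  rw [← monomial_zero', gaussianIntegral_monomial]
  simp only [Finsupp.coe_zero, Pi.zero_apply, gaussianMoment_zero, Finset.prod_mul_distrib,
    Finset.prod_const, Finset.card_univ, ← Complex.exp_sum, Finset.sum_div]
  ring

/-- A harmonic homogeneous polynomial is reproduced by integration against the complex Gaussian. -/
theorem gaussianIntegral_of_harmonic (z : ι → ℂ) {k : ℕ} {P : MvPolynomial ι ℂ}
    (hhom : P.IsHomogeneous k) (hharm : ∑ j, pderiv j (pderiv j P) = 0) :
    gaussianIntegral z P = ((2 * Real.pi : ℂ) ^ (1 / 2 : ℂ)) ^ Fintype.card ι *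
      cexp ((∑ j, z j ^ 2) / 2) * eval z P := by
  induction k generalizing P with
  | zero =>
    rw [← totalDegree_zero_iff_isHomogeneous, totalDegree_eq_zero_iff_eq_C] at hhom
    rw [hhom, gaussianIntegral_C, eval_C]
  | succ k ih =>
    have hcomm (i j : ι) (Q : MvPolynomial ι ℂ) :
        pderiv i (pderiv j Q) = pderiv j (pderiv i Q) := by
      have h : ⁅pderiv (R := ℂ) i, pderiv (R := ℂ) j⁆ = 0 := by
        classical
        refine MvPolynomial.derivation_ext fun l => ?_
        simp [Derivation.commutator_apply, pderiv_X, Pi.single_apply, apply_ite]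
      simpa [Derivation.commutator_apply, sub_eq_zero] using DFunLike.congr_fun h Q
    have hpderiv (i : ι) := ih (P := pderiv i P) hhom.pderiv (by
      simp only [hcomm _ i, ← map_sum, hharm, map_zero])
    have heuler := hhom.sum_X_mul_pderiv
    have h₁ := congrArg (gaussianIntegral z) heuler
    have h₂ := congrArg (eval z) heuler
    simp only [map_sum, gaussianIntegral_X_mul, Finset.sum_add_distrib, map_nsmul, hpderiv] at h₁
    rw [← map_sum, hharm, map_zero, add_zero, nsmul_eq_mul] at h₁
    simp only [map_sum, map_mul, eval_X, nsmul_eq_mul, map_natCast] at h₂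
    refine mul_left_cancel₀ (Nat.cast_ne_zero.mpr k.succ_ne_zero : ((k + 1 : ℕ) : ℂ) ≠ 0) ?_
    rw [← h₁, mul_left_comm, ← h₂, Finset.mul_sum]
    exact Finset.sum_congr rfl fun i _ => by ring

end Multivariate

/-- The short-time Fourier transform (Gaussian window `exp(-|x|²/4)`) of
`P(x)·exp(-|x|²/4)`, for a harmonic homogeneous polynomial `P` of degree `k`,
evaluated at `(2t, -ω)` equals `exp(-|z|²/2)·exp(i ω·t)·P(z)` with `z = t + iω`. -/
theorem stft_harmonic_homogeneous_polynomial
    (m : ℕ) (hm : 1 ≤ m) (k : ℕ) (P : MvPolynomial (Fin m) ℂ)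
    (hhom : P.IsHomogeneous k)
    (hharm : ∑ j : Fin m, MvPolynomial.pderiv j (MvPolynomial.pderiv j P) = 0) :
    ∀ t ω : Fin m → ℝ, ∀ z : Fin m → ℂ, (∀ j, z j = (t j : ℂ) + Complex.I * (ω j : ℂ)) →
      ((2 * Real.pi) ^ (-(m : ℝ) / 2) : ℝ) •
          ∫ x : Fin m → ℝ,
            MvPolynomial.eval (fun j => (x j : ℂ)) P *
              (Real.exp (-(∑ j, x j ^ 2) / 4) : ℂ) *
              (Real.exp (-(∑ j, (x j - 2 * t j) ^ 2) / 4) : ℂ) *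
              Complex.exp (Complex.I * ∑ j, (ω j : ℂ) * (x j : ℂ)) =
        (Real.exp (-(∑ j, ‖z j‖ ^ 2) / 2) : ℂ) *
          Complex.exp (Complex.I * ∑ j, (ω j : ℂ) * (t j : ℂ)) *
          MvPolynomial.eval z P := by
  intro t ω z hz
  have hint (x : Fin m → ℝ) :
      MvPolynomial.eval (fun j => (x j : ℂ)) P *
          (Real.exp (-(∑ j, x j ^ 2) / 4) : ℂ) *
          (Real.exp (-(∑ j, (x j - 2 * t j) ^ 2) / 4) : ℂ) *
          Complex.exp (Complex.I * ∑ j, (ω j : ℂ) * (x j : ℂ)) =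
        cexp (-∑ j, (t j : ℂ) ^ 2) * (MvPolynomial.eval (fun j => (x j : ℂ)) P *
          ∏ j, cexp (-(1 / 2) * (x j : ℂ) ^ 2 + z j * x j + 0)) := by
    rw [← Complex.exp_sum, mul_left_comm, ← Complex.exp_add]
    simp only [mul_assoc, ofReal_exp, ← Complex.exp_add]
    congr 2
    push_cast
    simp only [neg_div, Finset.sum_div, Finset.mul_sum, ← Finset.sum_neg_distrib,
      ← Finset.sum_add_distrib, hz]
    exact Finset.sum_congr rfl fun j _ => by ring
  have hconst : (((2 * Real.pi) ^ (-(m : ℝ) / 2) : ℝ) : ℂ) *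
      ((2 * Real.pi : ℂ) ^ (1 / 2 : ℂ)) ^ m = 1 := by
    have h2pi : (0 : ℝ) < 2 * Real.pi := by positivity
    have hsqrt : (2 * Real.pi : ℂ) ^ (1 / 2 : ℂ) = ((2 * Real.pi) ^ (1 / 2 : ℝ) : ℝ) := by
      rw [ofReal_cpow h2pi.le]
      push_cast
      rfl
    rw [hsqrt, ← ofReal_pow, ← ofReal_mul, ← Real.rpow_mul_natCast h2pi.le, ← Real.rpow_add h2pi]
    ring_nf
    simp
  have hexp : cexp (-∑ j, (t j : ℂ) ^ 2) * cexp ((∑ j, z j ^ 2) / 2) =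
      (Real.exp (-(∑ j, ‖z j‖ ^ 2) / 2) : ℂ) *
        cexp (Complex.I * ∑ j, (ω j : ℂ) * (t j : ℂ)) := by
    have hnorm (j : Fin m) : ‖z j‖ ^ 2 = t j ^ 2 + ω j ^ 2 := by
      rw [← Complex.normSq_eq_norm_sq, hz, mul_comm, Complex.normSq_add_mul_I]
    simp only [hnorm, ofReal_exp, ← Complex.exp_add]
    congr 1
    push_cast
    simp only [neg_div, Finset.sum_div, Finset.mul_sum, ← Finset.sum_neg_distrib,
      ← Finset.sum_add_distrib, hz]
    refine Finset.sum_congr rfl fun j _ => ?_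
    linear_combination (ω j : ℂ) ^ 2 / 2 * Complex.I_sq
  simp only [hint, integral_const_mul]
  rw [← gaussianIntegral_apply, gaussianIntegral_of_harmonic z hhom hharm, Fintype.card_fin,
    Complex.real_smul, ← hexp]
  linear_combination (cexp (-∑ j, (t j : ℂ) ^ 2) * cexp ((∑ j, z j ^ 2) / 2) *
    MvPolynomial.eval z P) * hconst
end

section
/- Let m ≥ 1, s ∈ ℕ, let E be a finite-dimensional complex inner product space, and for each multi-index α ∈ ℕ^m with |α| = Σ_j α_j = s let a_α ∈ E. Define P_s(z) = Σ_{|α|=s} z^α • a_α. Then for every z ∈ ℂ^m, ‖P_s(z)‖²_E ≤ (1/s!) · (Σ_{|α|=s} α! · ‖a_α‖²_E) · (Σ_{j=1}^m |z_j|²)^s. -/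
open Complex

/-- The multinomial theorem in exponential-coefficient form, over `antidiagonalTuple`. -/
theorem sum_antidiagonalTuple_prod_pow_div_factorial {K : Type*} [Field K] [CharZero K]
    (m s : ℕ) (x : Fin m → K) :
    ∑ α ∈ Finset.Nat.antidiagonalTuple m s, (∏ j, x j ^ α j) / ∏ j, ((α j).factorial : K) =
      (∑ j, x j) ^ s / (s.factorial : K) := by
  rw [Finset.sum_pow_eq_sum_piAntidiag, Finset.piAntidiag_univ_fin_eq_antidiagonalTuple,
    Finset.sum_div]
  refine Finset.sum_congr rfl fun α hα ↦ ?_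
  have hspec := Nat.multinomial_spec Finset.univ α
  rw [Finset.Nat.mem_antidiagonalTuple.mp hα] at hspec
  have hcast : (∏ j, ((α j).factorial : K)) * (Nat.multinomial Finset.univ α : K) =
      (s.factorial : K) := by exact_mod_cast hspec
  have hprod : (∏ j, ((α j).factorial : K)) ≠ 0 :=
    Finset.prod_ne_zero_iff.mpr fun j _ ↦ Nat.cast_ne_zero.mpr (Nat.factorial_ne_zero _)
  have hs : (s.factorial : K) ≠ 0 := Nat.cast_ne_zero.mpr (Nat.factorial_ne_zero _)
  rw [div_eq_div_iff hprod hs, ← hcast]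
  ring

/-- Pointwise bound of a homogeneous `E`-valued polynomial
`P_s(z) = Σ_{|α|=s} z^α • a_α` of degree `s` by its Segal–Bargmann (Fock) norm:
`‖P_s(z)‖² ≤ (1/s!) (Σ_{|α|=s} α! ‖a_α‖²) (Σ_j |z_j|²)^s` for all `z ∈ ℂ^m`. -/
theorem homogeneous_polynomial_pointwise_bound
    (m : ℕ) (hm : 1 ≤ m) (s : ℕ) {E : Type*} [NormedAddCommGroup E]
    [InnerProductSpace ℂ E] [FiniteDimensional ℂ E] (a : (Fin m → ℕ) → E) :
    ∀ z : Fin m → ℂ,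
      ‖∑ α ∈ Finset.Nat.antidiagonalTuple m s, (∏ j, z j ^ α j) • a α‖ ^ 2 ≤
        (1 / (s.factorial : ℝ)) *
          (∑ α ∈ Finset.Nat.antidiagonalTuple m s,
            (∏ j, ((α j).factorial : ℝ)) * ‖a α‖ ^ 2) *
          (∑ j, ‖z j‖ ^ 2) ^ s := by
  intro z
  have hfact (α : Fin m → ℕ) : 0 < ∏ j, ((α j).factorial : ℝ) :=
    Finset.prod_pos fun j _ ↦ Nat.cast_pos.mpr (Nat.factorial_pos _)
  calc
    _ ≤ (∑ α ∈ Finset.Nat.antidiagonalTuple m s, (∏ j, ‖z j‖ ^ α j) * ‖a α‖) ^ 2 := by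
      gcongr
      refine (norm_sum_le _ _).trans_eq ?_
      simp only [norm_smul, norm_prod, norm_pow]
    _ ≤ (∑ α ∈ Finset.Nat.antidiagonalTuple m s,
            (∏ j, ((α j).factorial : ℝ)) * ‖a α‖ ^ 2) *
          ∑ α ∈ Finset.Nat.antidiagonalTuple m s,
            (∏ j, (‖z j‖ ^ 2) ^ α j) / ∏ j, ((α j).factorial : ℝ) := by
      refine Finset.sum_sq_le_sum_mul_sum_of_sq_le_mul _ (fun α _ ↦ ?_) (fun α _ ↦ ?_)
        fun α _ ↦ ?_
      · exact mul_nonneg (hfact α).le (sq_nonneg _)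
      · exact div_nonneg (Finset.prod_nonneg fun j _ ↦ by positivity) (hfact α).le
      · refine le_of_eq ?_
        have hα := (hfact α).ne'
        simp only [pow_right_comm _ 2, Finset.prod_pow]
        field_simp
    _ = _ := by
      rw [sum_antidiagonalTuple_prod_pow_div_factorial]
      ring
end

section
/- Let m ≥ 1 and r ≥ 0. Then the family indexed by pairs (l, k) ∈ ℕ × ℕ given by C(m + k − 2, k) · r^(2(l+k)) / (l + k)! is summable, and its sum satisfies Σ_{l=0}^∞ Σ_{k=0}^∞ C(m + k − 2, k) · r^(2(l+k)) / (l + k)! ≤ exp(r²) · exp(2^m · r²). -/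
theorem Nat.multichoose_le_pow (n k : ℕ) : n.multichoose k ≤ n ^ k := by
  induction n, k using Nat.multichoose.induct with
  | case1 => simp
  | case2 => simp
  | case3 n k ih₁ ih₂ =>
    rw [Nat.multichoose_succ_succ]
    have h : n ^ k ≤ (n + 1) ^ k := Nat.pow_le_pow_left n.le_succ k
    calc n.multichoose (k + 1) + (n + 1).multichoose k
        ≤ n ^ (k + 1) + (n + 1) ^ k := by gcongr
      _ ≤ (n + 1) ^ (k + 1) := by
        rw [pow_succ, pow_succ]
        nlinarith

theorem Nat.choose_add_sub_two_le {m : ℕ} (hm : 1 ≤ m) (k : ℕ) :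
    (m + k - 2).choose k ≤ (2 ^ m) ^ k := by
  have h : (m + k - 2).choose k = (m - 1).multichoose k := by
    rw [Nat.multichoose_eq]
    congr 1
    omega
  rw [h]
  refine (Nat.multichoose_le_pow _ _).trans (Nat.pow_le_pow_left ?_ k)
  have := m.lt_two_pow_self
  omega

theorem Real.hasSum_exp (x : ℝ) : HasSum (fun n : ℕ => x ^ n / n.factorial) (Real.exp x) := by
  rw [Real.exp_eq_exp_ℝ]
  exact NormedSpace.expSeries_div_hasSum_exp x


/-- The dictionary series bound for the Segal–Bargmann transform: the family
`(l,k) ↦ C(m+k-2, k) r^{2(l+k)} / (l+k)!` is summable with sum at most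
`exp(r²)·exp(2^m r²)`. -/
theorem dictionary_series_bound (m : ℕ) (hm : 1 ≤ m) (r : ℝ) (hr : 0 ≤ r) :
    Summable (fun p : ℕ × ℕ =>
      (Nat.choose (m + p.2 - 2) p.2 : ℝ) * r ^ (2 * (p.1 + p.2)) /
        ((p.1 + p.2).factorial : ℝ)) ∧
    ∑' p : ℕ × ℕ,
        (Nat.choose (m + p.2 - 2) p.2 : ℝ) * r ^ (2 * (p.1 + p.2)) /
          ((p.1 + p.2).factorial : ℝ) ≤
      Real.exp (r ^ 2) * Real.exp (2 ^ m * r ^ 2) := by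
  have hx : 0 ≤ r ^ 2 := sq_nonneg r
  have hy : 0 ≤ 2 ^ m * r ^ 2 := by positivity
  have hsum : HasSum (fun p : ℕ × ℕ => (r ^ 2) ^ p.1 / (p.1.factorial : ℝ) *
      ((2 ^ m * r ^ 2) ^ p.2 / (p.2.factorial : ℝ)))
      (Real.exp (r ^ 2) * Real.exp (2 ^ m * r ^ 2)) :=
    (Real.hasSum_exp _).mul (Real.hasSum_exp _) <|
      (Real.hasSum_exp _).summable.mul_of_nonneg (Real.hasSum_exp _).summable
        (fun n => by positivity) (fun n => by positivity)
  have hle : ∀ p : ℕ × ℕ,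
      (Nat.choose (m + p.2 - 2) p.2 : ℝ) * r ^ (2 * (p.1 + p.2)) /
        ((p.1 + p.2).factorial : ℝ) ≤
      (r ^ 2) ^ p.1 / (p.1.factorial : ℝ) *
        ((2 ^ m * r ^ 2) ^ p.2 / (p.2.factorial : ℝ)) := by
    rintro ⟨l, k⟩
    have hc : ((m + k - 2).choose k : ℝ) ≤ (2 ^ m) ^ k := by
      exact_mod_cast Nat.choose_add_sub_two_le hm k
    have hf : (l.factorial : ℝ) * k.factorial ≤ (l + k).factorial := by
      exact_mod_cast Nat.le_of_dvd (Nat.factorial_pos _)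
        (Nat.factorial_mul_factorial_dvd_factorial_add l k)
    calc ((m + k - 2).choose k : ℝ) * r ^ (2 * (l + k)) / ((l + k).factorial : ℝ)
        ≤ (2 ^ m) ^ k * r ^ (2 * (l + k)) / (l.factorial * k.factorial) := by gcongr
      _ = (r ^ 2) ^ l / l.factorial * ((2 ^ m * r ^ 2) ^ k / k.factorial) := by
        rw [div_mul_div_comm, pow_mul, pow_add, mul_pow]
        ring
  have hs := Summable.of_nonneg_of_le (fun p => by positivity) hle hsum.summable
  exact ⟨hs, hasSum_le hle hs.hasSum hsum⟩
end
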